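/- arXiv:1909.10210 — 5 statements merged into one kernel-verified Lean document; each statement's English description precedes it below -/
import Mathlib

section
/- Let k ≥ 2 and let R be an associative ring with 1 in which 2·1 is invertible, and suppose R is Lie nilpotent of index k. Then for every 2×2 matrix A over R, if tr(A) = 0 and tr(A²) = 0, then A^{2^k} = 0. -/
/-- `lnc a [x₁,…,x_m]` is the left-normed commutator `[…[[a,x₁],x₂],…,x_m]`,
where `[a,b] = a*b - b*a`. -/
def lnc {R : Type*} [Ring R] : R → List R → R
  | a, [] => a
  | a, x :: l => lnc (a * x - x * a) l

/-- `LNC k x` is the left-normed commutator `[x 0, x 1, …, x k]` of the `k+1`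
elements `x 0, …, x k`. -/
def LNC {R : Type*} [Ring R] (k : ℕ) (x : ℕ → R) : R :=
  lnc (x 0) ((List.range k).map fun i => x (i + 1))

/-- A ring `R` is Lie nilpotent of index `k` if all left-normed commutators of
any `k+1` of its elements vanish. -/
def LieNilpotentOfIndex (R : Type*) [Ring R] (k : ℕ) : Prop :=
  ∀ x : ℕ → R, LNC k x = 0

section Lnc

variable {R : Type*} [Ring R]

theorem lnc_append_singleton (a x : R) (l : List R) :
    lnc a (l ++ [x]) = lnc a l * x - x * lnc a l := by
  induction l generalizing a with
  | nil => rfl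
  | cons y l ih => exact ih _

theorem map_lnc {S : Type*} [Ring S] (f : R →+* S) (a : R) (l : List R) :
    f (lnc a l) = lnc (f a) (l.map f) := by
  induction l generalizing a with
  | nil => rfl
  | cons y l ih => simp [lnc, ih]

theorem LieNilpotentOfIndex.lnc_eq_zero {k : ℕ} (h : LieNilpotentOfIndex R k) (a : R)
    (l : List R) (hl : l.length = k) : lnc a l = 0 := by
  have key := h fun i => (a :: l).getD i 0
  have hmap : (List.range k).map (fun i => (a :: l).getD (i + 1) 0) = l := by
    subst hl
    refine List.ext_getElem (by simp) fun i _ hi => ?_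
    simp [hi]
  simpa only [LNC, hmap, List.getD_cons_zero] using key

/-- If `[p, x]` is central for every `x`, then its product with any `[[q, z], y]` vanishes. -/
theorem commutator_mul_commutator_eq_zero {p : R}
    (hp : ∀ x t, (p * x - x * p) * t - t * (p * x - x * p) = 0) (x y q z : R) :
    (p * x - x * p) * ((q * z - z * q) * y - y * (q * z - z * q)) = 0 := by
  have hpq : p * (q * z - z * q) - (q * z - z * q) * p = 0 := by
    have h₁ := hp q z
    have h₂ := hp z q
    rw [← sub_zero (0 : R)]
    nth_rw 1 [← h₁]
    rw [← h₂]
    noncomm_ring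
  generalize q * z - z * q = s at hpq ⊢
  have h₁ := hp (x * s) y
  have h₂ : (p * x - x * p) * y - y * (p * x - x * p) = 0 := hp x y
  have hs : p * (x * s) - x * s * p = (p * x - x * p) * s + x * (p * s - s * p) := by noncomm_ring
  rw [hs, hpq, mul_zero, add_zero] at h₁
  calc (p * x - x * p) * (s * y - y * s)
      = ((p * x - x * p) * s * y - y * ((p * x - x * p) * s))
        - ((p * x - x * p) * y - y * (p * x - x * p)) * s := by noncomm_ring
    _ = 0 := by rw [h₁, h₂, zero_mul, sub_zero]

/-- If all commutators are central, then `[x, y] * [x, z] = 0`. -/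
theorem commutator_mul_commutator_left_eq_zero
    (hc : ∀ p x t : R, (p * x - x * p) * t - t * (p * x - x * p) = 0) (x y z : R) :
    (x * y - y * x) * (x * z - z * x) = 0 := by
  have h₁ := hc x (y * x) z
  have h₂ := hc x y z
  have e : x * (y * x) - y * x * x = (x * y - y * x) * x := by noncomm_ring
  rw [e] at h₁
  calc (x * y - y * x) * (x * z - z * x)
      = ((x * y - y * x) * x * z - z * ((x * y - y * x) * x))
        - ((x * y - y * x) * z - z * (x * y - y * x)) * x := by noncomm_ring
    _ = 0 := by rw [h₁, h₂, zero_mul, sub_zero]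

theorem pow_four_eq_zero_of_traces_eq_zero (h2 : IsUnit (2 : R))
    (hc : ∀ p x t : R, (p * x - x * p) * t - t * (p * x - x * p) = 0)
    (A : Matrix (Fin 2) (Fin 2) R) (h1 : A.trace = 0) (hsq : (A ^ 2).trace = 0) :
    A ^ 4 = 0 := by
  obtain ⟨a, b, c, d, rfl⟩ : ∃ a b c d, A = !![a, b; c, d] := ⟨_, _, _, _, A.eta_fin_two⟩
  obtain rfl : d = -a := by
    rw [Matrix.trace_fin_two_of] at h1
    exact (neg_eq_of_add_eq_zero_right h1).symm
  rw [pow_two, Matrix.mul_fin_two, Matrix.trace_fin_two_of] at hsq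
  obtain ⟨m, hm⟩ : ∃ m, m = a * a + b * c := ⟨_, rfl⟩
  have hm2 : 2 * m = b * c - c * b := by
    rw [hm, ← sub_eq_zero, ← hsq]; noncomm_ring
  have hA2 : (!![a, b; c, -a] : Matrix (Fin 2) (Fin 2) R) ^ 2
      = !![m, a * b - b * a; c * a - a * c, -m] := by
    rw [pow_two, Matrix.mul_fin_two]
    have h22 : c * b + -a * -a = -m := by
      rw [hm, ← sub_eq_zero, ← hsq]; noncomm_ring
    rw [h22, ← hm]
    simp only [mul_neg, neg_mul, ← sub_eq_add_neg]
  have hcomm (t : R) : m * t - t * m = 0 := by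
    refine h2.mul_left_cancel ?_
    rw [mul_zero, ← hc b c t, ← hm2]; noncomm_ring
  have hmm : m * m = 0 := by
    refine h2.mul_left_cancel (h2.mul_left_cancel ?_)
    have := commutator_mul_commutator_left_eq_zero hc b c c
    rw [← hm2] at this
    rw [mul_zero, mul_zero, ← this]; noncomm_ring
  have h12 : (a * b - b * a) * (c * a - a * c) = 0 := by
    rw [← neg_sub (a * c), mul_neg, commutator_mul_commutator_left_eq_zero hc, neg_zero]
  have h21 : (c * a - a * c) * (a * b - b * a) = 0 := by
    rw [← neg_sub (a * c), neg_mul, commutator_mul_commutator_left_eq_zero hc, neg_zero]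
  rw [show 4 = 2 * 2 from rfl, pow_mul, hA2, pow_two, Matrix.mul_fin_two, h12, h21]
  have e₁ := hcomm (a * b - b * a)
  have e₂ := hcomm (c * a - a * c)
  rw [← neg_sub, neg_eq_zero] at e₂
  simp only [mul_neg, neg_mul, hmm, ← sub_eq_add_neg, e₁, e₂, neg_zero, add_zero]
  ext i j; fin_cases i <;> fin_cases j <;> rfl

theorem lnc_mul_lnc_eq_zero {k : ℕ} (hk : 2 ≤ k)
    (hL : ∀ (a : R) (l : List R), l.length = k + 1 → lnc a l = 0)
    {a b : R} {l m : List R} (hl : l.length = k) (hm : m.length = k) :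
    lnc a l * lnc b m = 0 := by
  obtain ⟨l, x, rfl⟩ := l.eq_nil_or_concat.resolve_left (by rintro rfl; simp at hl; omega)
  obtain ⟨m, y, rfl⟩ := m.eq_nil_or_concat.resolve_left (by rintro rfl; simp at hm; omega)
  rw [List.concat_eq_append] at *
  simp only [List.length_append, List.length_singleton] at hl hm
  obtain ⟨m, z, rfl⟩ := m.eq_nil_or_concat.resolve_left (by rintro rfl; simp at hm; omega)
  simp only [List.concat_eq_append, lnc_append_singleton]
  refine commutator_mul_commutator_eq_zero (fun x t => ?_) x y _ z
  rw [← lnc_append_singleton, ← lnc_append_singleton]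
  exact hL _ _ (by simp [hl])

/-- The ideal generated by the left-normed commutators of `k + 1` elements. -/
def lncIdeal (R : Type*) [Ring R] (k : ℕ) : Ideal R :=
  Ideal.span {u | ∃ (a : R) (l : List R), l.length = k ∧ lnc a l = u}

theorem lnc_commute {k : ℕ}
    (hL : ∀ (a : R) (l : List R), l.length = k + 1 → lnc a l = 0)
    {a : R} {l : List R} (hl : l.length = k) (t : R) :
    Commute (lnc a l) t := by
  have := hL a (l ++ [t]) (by simp [hl])
  rwa [lnc_append_singleton, sub_eq_zero] at this

theorem lncIdeal_isTwoSided {k : ℕ}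
    (hL : ∀ (a : R) (l : List R), l.length = k + 1 → lnc a l = 0) :
    (lncIdeal R k).IsTwoSided := by
  refine ⟨fun {x} t hx => ?_⟩
  induction hx using Submodule.span_induction with
  | mem u hu =>
    obtain ⟨a, l, hl, rfl⟩ := hu
    rw [(lnc_commute hL hl t).eq]
    exact Ideal.mul_mem_left _ _ (Ideal.subset_span ⟨a, l, hl, rfl⟩)
  | zero => simp
  | add x y _ _ hx hy => rw [add_mul]; exact add_mem hx hy
  | smul r x _ hx => rw [smul_eq_mul, mul_assoc]; exact Ideal.mul_mem_left _ _ hx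

theorem mul_eq_zero_of_mem_lncIdeal {k : ℕ}
    (hL : ∀ (a : R) (l : List R), l.length = k + 1 → lnc a l = 0)
    (hk : 2 ≤ k) {x y : R} (hx : x ∈ lncIdeal R k)
    (hy : y ∈ lncIdeal R k) : x * y = 0 := by
  induction hx using Submodule.span_induction with
  | zero => simp
  | add x x' _ _ hx hx' => rw [add_mul, hx, hx', add_zero]
  | smul r x _ hx => rw [smul_eq_mul, mul_assoc, hx, mul_zero]
  | mem u hu =>
    obtain ⟨a, l, hl, rfl⟩ := hu
    induction hy using Submodule.span_induction with
    | zero => simp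
    | add y y' _ _ hy hy' => rw [mul_add, hy, hy', add_zero]
    | smul r y _ hy =>
      rw [smul_eq_mul, ← mul_assoc, (lnc_commute hL hl r).eq, mul_assoc, hy, mul_zero]
    | mem v hv =>
      obtain ⟨b, m, hm, rfl⟩ := hv
      exact lnc_mul_lnc_eq_zero hk hL hl hm

end Lnc

theorem pow_two_pow_eq_zero_of_lnc_eq_zero {k : ℕ} (hk : 2 ≤ k) :
    ∀ {R : Type*} [Ring R], IsUnit (2 : R) →
      (∀ (a : R) (l : List R), l.length = k → lnc a l = 0) →
      ∀ A : Matrix (Fin 2) (Fin 2) R, A.trace = 0 → (A ^ 2).trace = 0 → A ^ 2 ^ k = 0 := by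
  induction k, hk using Nat.le_induction with
  | base =>
    intro R _ h2 hL A h1 hsq
    exact pow_four_eq_zero_of_traces_eq_zero h2 (fun p x t => hL p [x, t] rfl) A h1 hsq
  | succ k hk ih =>
    intro R _ h2 hL A h1 hsq
    have := lncIdeal_isTwoSided hL
    let f := Ideal.Quotient.mk (lncIdeal R k)
    have hf : Function.Surjective f := Ideal.Quotient.mk_surjective
    have hB : f.mapMatrix A ^ 2 ^ k = 0 := by
      refine ih (by simpa only [map_ofNat] using h2.map f) ?_ _ ?_ ?_
      · intro a l hl
        obtain ⟨a, rfl⟩ := hf a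
        obtain ⟨l, rfl⟩ := hf.list_map l
        rw [List.length_map] at hl
        rw [← map_lnc]
        exact Ideal.Quotient.eq_zero_iff_mem.2 (Ideal.subset_span ⟨a, l, hl, rfl⟩)
      · rw [RingHom.mapMatrix_apply, ← AddMonoidHom.map_trace, h1, map_zero]
      · rw [← map_pow, RingHom.mapMatrix_apply, ← AddMonoidHom.map_trace, hsq, map_zero]
    rw [← map_pow] at hB
    have hmem (i j) : (A ^ 2 ^ k) i j ∈ lncIdeal R k :=
      Ideal.Quotient.eq_zero_iff_mem.1 (congrFun (congrFun hB i) j)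
    rw [pow_succ, pow_mul, pow_two]
    ext i j
    rw [Matrix.mul_apply]
    exact Finset.sum_eq_zero fun x _ => mul_eq_zero_of_mem_lncIdeal hL hk (hmem i x) (hmem x j)

/-- If `1/2 ∈ R` and `R` is Lie nilpotent of index `k ≥ 2`, then for every `2×2` matrix
`A` over `R`, `tr(A) = tr(A²) = 0` implies `A^(2^k) = 0`. -/
theorem pow_two_pow_eq_zero_of_traces_eq_zero
    (k : ℕ) (hk : 2 ≤ k) (R : Type*) [Ring R] (h2 : IsUnit (2 : R))
    (hL : LieNilpotentOfIndex R k)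
    (A : Matrix (Fin 2) (Fin 2) R)
    (h1 : A.trace = 0) (hsq : (A ^ 2).trace = 0) :
    A ^ 2 ^ k = 0 := by
  exact pow_two_pow_eq_zero_of_lnc_eq_zero hk h2 hL.lnc_eq_zero A h1 hsq
end

section
/- Let K be a commutative ring and V a K-module. Then the exterior (Grassmann) algebra Λ(V) over K is Lie nilpotent of index 2; that is, [[x,y],z] = 0 for all x, y, z ∈ Λ(V), where [a,b] = ab − ba. -/
namespace ExteriorAlgebra

variable {K : Type*} [CommRing K] {V : Type*} [AddCommGroup V] [Module K V]

/-- Products of two generators are central. -/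
theorem commute_ι_mul_ι (v w : V) (z : ExteriorAlgebra K V) : Commute (ι K v * ι K w) z := by
  induction z using ExteriorAlgebra.induction with
  | algebraMap r => exact Algebra.commutes' r _ |>.symm
  | ι u =>
    have hw := eq_neg_of_add_eq_zero_left (ι_add_mul_swap (R := K) w u)
    have hv := eq_neg_of_add_eq_zero_left (ι_add_mul_swap (R := K) v u)
    rw [commute_iff_eq, mul_assoc, hw, mul_neg, ← mul_assoc, hv, neg_mul, neg_neg, mul_assoc]
  | mul a b ha hb => exact ha.mul_right hb
  | add a b ha hb => exact ha.add_right hb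

/-- Elements of even degree are central. -/
theorem commute_of_mem_even {x : ExteriorAlgebra K V}
    (hx : x ∈ CliffordAlgebra.evenOdd (0 : QuadraticForm K V) 0) (z : ExteriorAlgebra K V) :
    Commute x z := by
  induction x, hx using CliffordAlgebra.even_induction with
  | algebraMap r => exact Algebra.commutes' r z
  | add x y hx hy ihx ihy => exact ihx.add_left ihy
  | ι_mul_ι_mul v w x hx ih => exact (commute_ι_mul_ι v w z).mul_left ih

/-- Every element is the sum of an even and an odd element. -/
theorem exists_even_add_odd (x : ExteriorAlgebra K V) :
    ∃ a ∈ CliffordAlgebra.evenOdd (0 : QuadraticForm K V) 0,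
      ∃ b ∈ CliffordAlgebra.evenOdd (0 : QuadraticForm K V) 1, a + b = x :=
  Submodule.mem_sup.mp <|
    (CliffordAlgebra.evenOdd_isCompl (0 : QuadraticForm K V)).sup_eq_top ▸ Submodule.mem_top

/-- Commutators have even degree. -/
theorem commutator_mem_even (x y : ExteriorAlgebra K V) :
    x * y - y * x ∈ CliffordAlgebra.evenOdd (0 : QuadraticForm K V) 0 := by
  obtain ⟨a, ha, b, hb, rfl⟩ := exists_even_add_odd x
  obtain ⟨c, hc, d, hd, rfl⟩ := exists_even_add_odd y
  have key : (a + b) * (c + d) - (c + d) * (a + b) = b * d - d * b := by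
    have h₁ := (commute_of_mem_even ha (c + d)).eq
    have h₂ := (commute_of_mem_even hc b).eq
    rw [add_mul a b, mul_add (c + d), h₁, mul_add b, add_mul c d b, h₂]
    abel
  rw [key]
  exact sub_mem (SetLike.mul_mem_graded (i := (1 : ZMod 2)) (j := 1) hb hd)
    (SetLike.mul_mem_graded (i := (1 : ZMod 2)) (j := 1) hd hb)

end ExteriorAlgebra

/-- The exterior (Grassmann) algebra `Λ(V)` of a module `V` over a commutative ring `K`
is Lie nilpotent of index 2: `[[x,y],z] = 0` for all `x, y, z ∈ Λ(V)`,
where `[a,b] = ab − ba`. -/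
theorem exteriorAlgebra_lieNilpotent_index_two
    (K : Type*) [CommRing K] (V : Type*) [AddCommGroup V] [Module K V]
    (x y z : ExteriorAlgebra K V) :
    (x * y - y * x) * z - z * (x * y - y * x) = 0 :=
  sub_eq_zero.mpr (ExteriorAlgebra.commute_of_mem_even
    (ExteriorAlgebra.commutator_mem_even x y) z).eq
end

section
/- Let t ≥ 1 and let R be an associative ring with 1 satisfying the identity [[x,y],z] = 0 (Lie nilpotency of index 2). Then the ring U_t(R) of t×t upper triangular matrices over R satisfies the identity [[X₁,Y₁],Z₁]·[[X₂,Y₂],Z₂]⋯[[X_t,Y_t],Z_t] = 0; that is, for all upper triangular t×t matrices X₁,…,X_t, Y₁,…,Y_t, Z₁,…,Z_t over R, the product of the double commutators [[X_i,Y_i],Z_i], taken in order for i = 1, …, t, is the zero matrix. -/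
namespace Matrix

variable {t : ℕ} {R : Type*}

theorem mul_apply_diag_of_blockTriangular_id [NonUnitalNonAssocSemiring R]
    {A B : Matrix (Fin t) (Fin t) R}
    (hA : A.BlockTriangular id) (hB : B.BlockTriangular id) (r : Fin t) :
    (A * B) r r = A r r * B r r := by
  rw [mul_apply]
  refine Finset.sum_eq_single r (fun k _ hk => ?_) (by simp)
  rcases lt_or_gt_of_ne hk with h | h
  · rw [hA h, zero_mul]
  · rw [hB h, mul_zero]

theorem list_prod_map_range_apply_eq_zero [Semiring R] {A : ℕ → Matrix (Fin t) (Fin t) R}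
    (hA : ∀ i, ∀ r s : Fin t, s ≤ r → A i r s = 0) (n : ℕ) (r s : Fin t)
    (hrs : (s : ℕ) < r + n) : ((List.range n).map A).prod r s = 0 := by
  induction n generalizing s with
  | zero =>
    have h : r ≠ s := by rintro rfl; omega
    simp [one_apply_ne h]
  | succ n ih =>
    rw [List.range_succ, List.map_append, List.prod_append, List.map_singleton,
      List.prod_singleton, mul_apply]
    refine Finset.sum_eq_zero fun k _ => ?_
    by_cases hk : (k : ℕ) < r + n
    · rw [ih k hk, zero_mul]
    · rw [hA n k s (Fin.le_def.mpr (by omega)), mul_zero]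

theorem doubleCommutator_apply_eq_zero [Ring R]
    (hL : ∀ x y z : R, (x * y - y * x) * z - z * (x * y - y * x) = 0)
    {X Y Z : Matrix (Fin t) (Fin t) R} (hX : X.BlockTriangular id)
    (hY : Y.BlockTriangular id) (hZ : Z.BlockTriangular id) {r s : Fin t} (hsr : s ≤ r) :
    ((X * Y - Y * X) * Z - Z * (X * Y - Y * X)) r s = 0 := by
  have hC : (X * Y - Y * X).BlockTriangular id := (hX.mul hY).sub (hY.mul hX)
  rcases hsr.lt_or_eq with h | rfl
  · exact ((hC.mul hZ).sub (hZ.mul hC)) h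
  · rw [sub_apply, mul_apply_diag_of_blockTriangular_id hC hZ,
      mul_apply_diag_of_blockTriangular_id hZ hC, sub_apply,
      mul_apply_diag_of_blockTriangular_id hX hY, mul_apply_diag_of_blockTriangular_id hY hX]
    exact hL _ _ _

end Matrix

/-- If `R` satisfies `[[x,y],z] = 0` (Lie nilpotency of index 2), then the ring
`U_t(R)` of `t×t` upper triangular matrices over `R` (`t ≥ 1`) satisfies the identity
`[[X₁,Y₁],Z₁]·[[X₂,Y₂],Z₂]⋯[[X_t,Y_t],Z_t] = 0`. -/
theorem upperTriangular_prod_doubleCommutators_eq_zero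
    (t : ℕ) (ht : 1 ≤ t) (R : Type*) [Ring R]
    (hL : ∀ x y z : R, (x * y - y * x) * z - z * (x * y - y * x) = 0)
    (X Y Z : ℕ → Matrix (Fin t) (Fin t) R)
    (hX : ∀ i, ∀ r s : Fin t, s < r → X i r s = 0)
    (hY : ∀ i, ∀ r s : Fin t, s < r → Y i r s = 0)
    (hZ : ∀ i, ∀ r s : Fin t, s < r → Z i r s = 0) :
    ((List.range t).map fun i =>
      (X i * Y i - Y i * X i) * Z i - Z i * (X i * Y i - Y i * X i)).prod = 0 := by
  ext r s
  exact Matrix.list_prod_map_range_apply_eq_zero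
    (fun i _ _ hsr => Matrix.doubleCommutator_apply_eq_zero hL
      (fun r s h => hX i r s h) (fun r s h => hY i r s h) (fun r s h => hZ i r s h) hsr)
    t r s (by omega)
end

section
/- Let t ≥ 1 and let R be an associative ring with 1 satisfying the polynomial identity [x₁,y₁]·[x₂,y₂]⋯[x_t,y_t] = 0 (for all substitutions of elements of R). Then the commutator ideal T = R[R,R]R satisfies T^t = {0}; that is, for any elements c₁, …, c_t ∈ T, the product c₁c₂⋯c_t equals 0. -/
/-- The left ideal generated by all products of `k` additive commutators. -/
def commutatorProdSpan (R : Type*) [Ring R] (k : ℕ) : Submodule R R :=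
  Submodule.span R
    {w | ∃ x y : ℕ → R, w = ((List.range k).map fun i => x i * y i - y i * x i).prod}

section commutatorProdSpan

variable {R : Type*} [Ring R] {k : ℕ} {m : R}

theorem mul_commutator_mem_commutatorProdSpan (hm : m ∈ commutatorProdSpan R k) (a b : R) :
    m * (a * b - b * a) ∈ commutatorProdSpan R (k + 1) := by
  induction hm using Submodule.span_induction with
  | mem w hw =>
    obtain ⟨x, y, rfl⟩ := hw
    refine Submodule.subset_span
      ⟨fun i => if i < k then x i else a, fun i => if i < k then y i else b, ?_⟩
    rw [List.range_succ, List.map_append, List.prod_append]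
    congr 1
    · congr 1
      refine List.map_congr_left fun i hi => ?_
      simp [List.mem_range.mp hi]
    · simp
  | zero => simp
  | add u v _ _ hu hv => rw [add_mul]; exact add_mem hu hv
  | smul r u _ hu => rw [smul_mul_assoc]; exact Submodule.smul_mem _ r hu

theorem mul_mem_commutatorProdSpan (hm : m ∈ commutatorProdSpan R k) (r : R) :
    m * r ∈ commutatorProdSpan R k := by
  induction k generalizing m r with
  | zero =>
    have one_mem : (1 : R) ∈ commutatorProdSpan R 0 := Submodule.subset_span ⟨0, 0, by simp⟩
    simpa using Submodule.smul_mem _ (m * r) one_mem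
  | succ k ih =>
    induction hm using Submodule.span_induction with
    | mem w hw =>
      obtain ⟨x, y, rfl⟩ := hw
      rw [List.range_succ, List.map_append, List.prod_append, List.map_singleton,
        List.prod_singleton]
      have hw : ((List.range k).map fun i => x i * y i - y i * x i).prod ∈
          commutatorProdSpan R k := Submodule.subset_span ⟨x, y, rfl⟩
      generalize ((List.range k).map fun i => x i * y i - y i * x i).prod = w at hw ⊢
      have leibniz : w * (x k * y k - y k * x k) * r =
          w * (x k * (y k * r) - y k * r * x k) - w * y k * (x k * r - r * x k) := by
        noncomm_ring
      rw [leibniz]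
      exact sub_mem (mul_commutator_mem_commutatorProdSpan hw _ _)
        (mul_commutator_mem_commutatorProdSpan (ih hw _) _ _)
    | zero => simp
    | add u v _ _ hu hv => rw [add_mul]; exact add_mem hu hv
    | smul s u _ hu => rw [smul_mul_assoc]; exact Submodule.smul_mem _ s hu

theorem mul_mem_commutatorProdSpan_succ (hm : m ∈ commutatorProdSpan R k) {c : R}
    (hc : c ∈ TwoSidedIdeal.span {u : R | ∃ a b : R, u = a * b - b * a}) :
    m * c ∈ commutatorProdSpan R (k + 1) := by
  induction hc using TwoSidedIdeal.span_induction generalizing m with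
  | mem u hu =>
    obtain ⟨a, b, rfl⟩ := hu
    exact mul_commutator_mem_commutatorProdSpan hm a b
  | zero => simp
  | add u v _ _ hu hv => rw [mul_add]; exact add_mem (hu hm) (hv hm)
  | neg u _ hu => rw [mul_neg]; exact neg_mem (hu hm)
  | left_absorb r u _ hu =>
    rw [← mul_assoc]; exact hu (mul_mem_commutatorProdSpan hm r)
  | right_absorb r u _ hu =>
    rw [← mul_assoc]; exact mul_mem_commutatorProdSpan (hu hm) r

theorem prod_mem_commutatorProdSpan (c : ℕ → R)
    (hc : ∀ i < k, c i ∈ TwoSidedIdeal.span {u : R | ∃ a b : R, u = a * b - b * a}) :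
    ((List.range k).map c).prod ∈ commutatorProdSpan R k := by
  induction k with
  | zero => exact Submodule.subset_span ⟨0, 0, by simp⟩
  | succ k ih =>
    rw [List.range_succ, List.map_append, List.prod_append, List.map_singleton,
      List.prod_singleton]
    exact mul_mem_commutatorProdSpan_succ (ih fun i hi => hc i (hi.trans k.lt_succ_self))
      (hc k k.lt_succ_self)

end commutatorProdSpan

/-- If `R` satisfies the polynomial identity `[x₁,y₁]·[x₂,y₂]⋯[x_t,y_t] = 0` (`t ≥ 1`),
then the commutator ideal `T = R[R,R]R` satisfies `T^t = {0}`: any product of `t`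
elements of `T` vanishes. -/
theorem prod_mem_commutatorIdeal_eq_zero_of_PI
    (t : ℕ) (ht : 1 ≤ t) (R : Type*) [Ring R]
    (hPI : ∀ x y : ℕ → R,
      ((List.range t).map fun i => x i * y i - y i * x i).prod = 0)
    (T : TwoSidedIdeal R)
    (hT : T = TwoSidedIdeal.span {u | ∃ a b : R, u = a * b - b * a})
    (c : ℕ → R) (hc : ∀ i, i < t → c i ∈ T) :
    ((List.range t).map c).prod = 0 := by
  subst hT
  have hbot : commutatorProdSpan R t = ⊥ := by
    refine Submodule.span_eq_bot.mpr ?_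
    rintro _ ⟨x, y, rfl⟩
    exact hPI x y
  simpa [hbot] using prod_mem_commutatorProdSpan c hc
end

section
/- Let d ≥ 1, n ≥ 1, and let R be an associative algebra with 1 over a field of characteristic zero (equivalently, a ℚ-algebra) satisfying the polynomial identity [x₁,y₁]·[x₂,y₂]⋯[x_d,y_d] = 0. Let A be an n×n matrix over R such that tr(A) = tr(A²) = ⋯ = tr(Aⁿ) = 0. Then A^{n·d} = 0. -/
open Polynomial in
/-- Jacobi's formula for the characteristic matrix. -/
theorem Matrix.derivative_charpoly_eq_trace_adjugate {ι S : Type*} [Fintype ι] [DecidableEq ι]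
    [CommRing S] (A : Matrix ι ι S) :
    derivative A.charpoly = A.charmatrix.adjugate.trace := by
  have hderiv (i j : ι) : derivative (A.charmatrix i j) = (1 : Matrix ι ι S[X]) i j := by
    by_cases h : i = j <;> simp [Matrix.one_apply, h]
  rw [Matrix.charpoly, ← Matrix.det_transpose, Matrix.det_apply, map_sum, Matrix.trace]
  simp_rw [Matrix.diag_apply, Matrix.adjugate_apply, ← Matrix.det_transpose (updateRow _ _ _),
    Matrix.det_apply]
  rw [Finset.sum_comm]
  refine Finset.sum_congr rfl fun σ _ => ?_
  simp_rw [Matrix.transpose_apply]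
  rw [← Finset.smul_sum, Units.smul_def, Units.smul_def, map_zsmul, derivative_prod_finset]
  congr 1
  refine Finset.sum_congr rfl fun a ha => ?_
  rw [hderiv, ← Finset.prod_erase_mul _ _ ha, Matrix.updateRow_self, Matrix.one_apply,
    Pi.single_apply]
  simp_rw [eq_comm (a := a)]
  congr 1
  refine Finset.prod_congr rfl fun b hb => ?_
  rw [Matrix.updateRow_ne (Finset.ne_of_mem_erase hb)]

open Polynomial in
/-- The recursion satisfied by the coefficients of the adjugate of the characteristic matrix. -/
theorem Matrix.coeff_adjugate_charmatrix {ι S : Type*} [Fintype ι] [DecidableEq ι]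
    [CommRing S] (A : Matrix ι ι S) :
    A * (matPolyEquiv A.charmatrix.adjugate).coeff 0 + A.charpoly.coeff 0 • 1 = 0 ∧
    ∀ j, (matPolyEquiv A.charmatrix.adjugate).coeff j =
      A * (matPolyEquiv A.charmatrix.adjugate).coeff (j + 1) + A.charpoly.coeff (j + 1) • 1 := by
  have h := congrArg matPolyEquiv (Matrix.mul_adjugate A.charmatrix)
  rw [map_mul, matPolyEquiv_charmatrix, ← Matrix.charpoly, matPolyEquiv_smul_one, sub_mul] at h
  constructor
  · have h0 := congrArg (fun p => coeff p 0) h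
    simp only [coeff_sub, coeff_X_mul_zero, coeff_C_mul, coeff_map, zero_sub,
      Algebra.algebraMap_eq_smul_one] at h0
    rw [← h0, add_neg_cancel]
  · intro j
    have hj := congrArg (fun p => coeff p (j + 1)) h
    simp only [coeff_sub, coeff_X_mul, coeff_C_mul, coeff_map,
      Algebra.algebraMap_eq_smul_one] at hj
    rw [← hj, add_sub_cancel]

open Polynomial in
theorem Matrix.trace_mul_coeff_adjugate_charmatrix {ι S : Type*} [Fintype ι] [DecidableEq ι]
    [CommRing S] (A : Matrix ι ι S)
    (htr : ∀ i : ℕ, 1 ≤ i → i ≤ Fintype.card ι → (A ^ i).trace = 0) (j : ℕ) :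
    (A * (matPolyEquiv A.charmatrix.adjugate).coeff j).trace = 0 := by
  nontriviality S
  set N := matPolyEquiv A.charmatrix.adjugate with hN
  have expand (m : ℕ) : N.coeff j =
      ∑ i ∈ Finset.range m, A.charpoly.coeff (j + 1 + i) • A ^ i + A ^ m * N.coeff (j + m) := by
    induction m with
    | zero => simp
    | succ m ih =>
      rw [ih, A.coeff_adjugate_charmatrix.2 (j + m), Finset.sum_range_succ, ← hN, mul_add,
        ← mul_assoc, ← pow_succ, mul_smul_comm, mul_one, ← add_assoc j m 1,
        add_right_comm j m 1, ← add_assoc, add_right_comm (Finset.sum _ _)]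
  rw [expand (N.natDegree + 1), coeff_eq_zero_of_natDegree_lt (by omega), mul_zero, add_zero,
    Finset.mul_sum, Matrix.trace_sum]
  refine Finset.sum_eq_zero fun i _ => ?_
  rw [mul_smul_comm, ← pow_succ', Matrix.trace_smul]
  by_cases hi : i + 1 ≤ Fintype.card ι
  · rw [htr _ (by omega) hi, smul_zero]
  · rw [coeff_eq_zero_of_natDegree_lt (by rw [A.charpoly_natDegree_eq_dim]; omega), zero_smul]

open Polynomial in
theorem Matrix.pow_card_eq_zero_of_trace_pow_eq_zero {ι S : Type*} [Fintype ι] [DecidableEq ι]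
    [CommRing S] [Algebra ℚ S] (A : Matrix ι ι S)
    (htr : ∀ i : ℕ, 1 ≤ i → i ≤ Fintype.card ι → (A ^ i).trace = 0) :
    A ^ Fintype.card ι = 0 := by
  nontriviality S
  have cancel {q : ℚ} (hq : q ≠ 0) {c : S} (h : algebraMap ℚ S q * c = 0) : c = 0 :=
    ((hq.isUnit.map (algebraMap ℚ S)).mul_right_eq_zero).1 h
  have htrace (j : ℕ) : ((matPolyEquiv A.charmatrix.adjugate).coeff j).trace =
      (derivative A.charpoly).coeff j := by
    rw [A.derivative_charpoly_eq_trace_adjugate]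
    simp [Matrix.trace, matPolyEquiv_coeff_apply]
  have hcoeff (k : ℕ) (hk : k ≠ Fintype.card ι) : A.charpoly.coeff k = 0 := by
    cases k with
    | zero =>
      have h := congrArg Matrix.trace A.coeff_adjugate_charmatrix.1
      rw [Matrix.trace_add, A.trace_mul_coeff_adjugate_charmatrix htr, Matrix.trace_smul,
        Matrix.trace_one, Matrix.trace_zero, zero_add, smul_eq_mul] at h
      refine cancel (q := Fintype.card ι) (by exact_mod_cast hk.symm) ?_
      rw [map_natCast, mul_comm, h]
    | succ j =>
      have h := congrArg Matrix.trace (A.coeff_adjugate_charmatrix.2 j)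
      rw [Matrix.trace_add, A.trace_mul_coeff_adjugate_charmatrix htr, Matrix.trace_smul,
        Matrix.trace_one, zero_add, smul_eq_mul, htrace, coeff_derivative] at h
      refine cancel (q := (j + 1 : ℕ) - Fintype.card ι)
        (sub_ne_zero.2 (by exact_mod_cast hk)) ?_
      rw [map_sub, map_natCast, map_natCast]
      push_cast
      linear_combination h
  have hX : A.charpoly = X ^ Fintype.card ι := by
    ext k
    rw [coeff_X_pow]
    split_ifs with hk
    · rw [hk, ← A.charpoly_natDegree_eq_dim]
      exact A.charpoly_monic.coeff_natDegree
    · exact hcoeff k hk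
  simpa [hX] using A.aeval_self_charpoly

/-- The ideal generated by all additive commutators. -/
def commutatorIdeal (R : Type*) [Ring R] : Ideal R :=
  Ideal.span {c | ∃ x y : R, c = x * y - y * x}

theorem commutator_mem_commutatorIdeal {R : Type*} [Ring R] (x y : R) :
    x * y - y * x ∈ commutatorIdeal R :=
  Ideal.subset_span ⟨x, y, rfl⟩

instance commutatorIdeal.isTwoSided (R : Type*) [Ring R] : (commutatorIdeal R).IsTwoSided := by
  refine ⟨fun {a} b ha => ?_⟩
  rw [← add_sub_cancel (b * a) (a * b)]
  exact add_mem (Ideal.mul_mem_left _ b ha) (commutator_mem_commutatorIdeal a b)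

theorem commutatorIdeal_pow_le {R : Type*} [Ring R] (d : ℕ) :
    commutatorIdeal R ^ d ≤ Ideal.span {c | ∃ x y : ℕ → R,
      c = ((List.range d).map fun i => x i * y i - y i * x i).prod} := by
  induction d with
  | zero =>
    have h : (1 : R) ∈ Ideal.span {c : R | ∃ x y : ℕ → R,
        c = ((List.range 0).map fun i => x i * y i - y i * x i).prod} :=
      Ideal.subset_span ⟨0, 0, by simp⟩
    rw [(Ideal.eq_top_iff_one _).2 h]
    exact le_top
  | succ d ih =>
    rw [Ideal.IsTwoSided.pow_succ]
    refine (Ideal.mul_mono_right ih).trans (Ideal.mul_le.2 fun a ha b hb => ?_)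
    have hcons (x y : R) (u v : ℕ → R) :
        (x * y - y * x) * ((List.range d).map fun i => u i * v i - v i * u i).prod ∈
        Ideal.span {c : R | ∃ x y : ℕ → R,
          c = ((List.range (d + 1)).map fun i => x i * y i - y i * x i).prod} := by
      refine Ideal.subset_span ⟨fun i => Nat.casesOn i x u, fun i => Nat.casesOn i y v, ?_⟩
      rw [List.range_succ_eq_map]
      simp [Function.comp_def]
    induction hb using Submodule.span_induction generalizing a with
    | zero => simp
    | add b b' _ _ hb hb' => rw [mul_add]; exact add_mem (hb a ha) (hb' a ha)
    | smul r b _ hb =>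
      rw [smul_eq_mul, ← mul_assoc]
      exact hb _ (Ideal.mul_mem_right r _ ha)
    | mem b hb =>
      obtain ⟨u, v, rfl⟩ := hb
      induction ha using Submodule.span_induction with
      | zero => simp
      | add a a' _ _ ha ha' => rw [add_mul]; exact add_mem ha ha'
      | smul r a _ ha => rw [smul_eq_mul, mul_assoc]; exact Ideal.mul_mem_left _ r ha
      | mem a ha =>
        obtain ⟨x, y, rfl⟩ := ha
        exact hcons x y u v

theorem Matrix.pow_apply_mem_ideal_pow {ι R : Type*} [Fintype ι] [DecidableEq ι] [Ring R]
    (I : Ideal R) [I.IsTwoSided] {B : Matrix ι ι R} (hB : ∀ i j, B i j ∈ I) (k : ℕ) (i j : ι) :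
    (B ^ k) i j ∈ I ^ k := by
  induction k generalizing i j with
  | zero => simp [Submodule.pow_zero, Ideal.one_eq_top]
  | succ k ih =>
    rw [pow_succ', Ideal.IsTwoSided.pow_succ, Matrix.mul_apply]
    exact sum_mem fun l _ => Ideal.mul_mem_mul (hB i l) (ih l j)

/-- Let `R` be an algebra over a field of characteristic zero (equivalently, a
`ℚ`-algebra) satisfying `[x₁,y₁]·[x₂,y₂]⋯[x_d,y_d] = 0` (`d ≥ 1`). If an `n×n` matrix
`A` over `R` (`n ≥ 1`) satisfies `tr(A) = tr(A²) = ⋯ = tr(Aⁿ) = 0`, then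
`A^(n·d) = 0`. -/
theorem pow_eq_zero_of_traces_eq_zero_of_commutator_PI
    (d n : ℕ) (hd : 1 ≤ d) (hn : 1 ≤ n)
    (R : Type*) [Ring R] [Algebra ℚ R]
    (hPI : ∀ x y : ℕ → R,
      ((List.range d).map fun i => x i * y i - y i * x i).prod = 0)
    (A : Matrix (Fin n) (Fin n) R)
    (htr : ∀ i : ℕ, 1 ≤ i → i ≤ n → (A ^ i).trace = 0) :
    A ^ (n * d) = 0 := by
  let : CommRing (R ⧸ commutatorIdeal R) :=
    { (inferInstance : Ring (R ⧸ commutatorIdeal R)) with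
      mul_comm := by
        rintro ⟨a⟩ ⟨b⟩
        exact Ideal.Quotient.eq.2 (commutator_mem_commutatorIdeal a b) }
  let π : R →+* R ⧸ commutatorIdeal R := Ideal.Quotient.mk (commutatorIdeal R)
  let : Algebra ℚ (R ⧸ commutatorIdeal R) := (π.comp (algebraMap ℚ R)).toAlgebra
  have hpow : π.mapMatrix A ^ n = 0 := by
    simpa using (π.mapMatrix A).pow_card_eq_zero_of_trace_pow_eq_zero fun i hi hin => by
      rw [← map_pow, RingHom.mapMatrix_apply, ← AddMonoidHom.map_trace π,
        htr i hi (by simpa using hin), map_zero]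
  have hmem (i j : Fin n) : (A ^ n) i j ∈ commutatorIdeal R := by
    rw [← Ideal.Quotient.eq_zero_iff_mem]
    rw [← map_pow] at hpow
    exact congrFun (congrFun hpow i) j
  have hbot : commutatorIdeal R ^ d ≤ ⊥ := by
    refine (commutatorIdeal_pow_le d).trans (Ideal.span_le.2 ?_)
    rintro _ ⟨x, y, rfl⟩
    exact hPI x y
  ext i j
  rw [pow_mul]
  exact hbot (Matrix.pow_apply_mem_ideal_pow _ hmem d i j)
end
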